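/- arXiv:2011.05770 — 6 statements merged into one kernel-verified Lean document; each statement's English description precedes it below -/
import Mathlib

section
/- The group homomorphism from the free group on two generators F₂ to SL(2,ℤ) sending the first generator to the matrix [[1,2],[0,1]] and the second generator to the matrix [[1,0],[2,1]] is injective; that is, these two matrices freely generate a free subgroup of SL(2,ℤ) of rank 2. -/
/-- The matrix `[[1,2],[0,1]]` as an element of `SL(2,ℤ)`. -/
def sanovA : Matrix.SpecialLinearGroup (Fin 2) ℤ :=
  ⟨!![1, 2; 0, 1], by norm_num [Matrix.det_fin_two_of]⟩

/-- The matrix `[[1,0],[2,1]]` as an element of `SL(2,ℤ)`. -/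
def sanovB : Matrix.SpecialLinearGroup (Fin 2) ℤ :=
  ⟨!![1, 0; 2, 1], by norm_num [Matrix.det_fin_two_of]⟩

namespace Sanov

/-- The elements of `SL(2,ℤ)` whose first column `(x, y)` has slope satisfying `x / y ≥ 1`
(with `y = 0` allowed), respectively `0 ≤ x / y < 1`. -/
def posSet : Fin 2 → Set (Matrix.SpecialLinearGroup (Fin 2) ℤ) :=
  ![{g | 0 ≤ g 1 0 * (g 0 0 - g 1 0)}, {g | 0 < g 0 0 * (g 1 0 - g 0 0) ∨ g 0 0 = 0}]

/-- The elements of `SL(2,ℤ)` whose first column `(x, y)` satisfies `x / y < -1`, respectively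
`-1 ≤ x / y < 0`. -/
def negSet : Fin 2 → Set (Matrix.SpecialLinearGroup (Fin 2) ℤ) :=
  ![{g | g 1 0 * (g 0 0 + g 1 0) < 0}, {g | g 0 0 * (g 0 0 + g 1 0) ≤ 0 ∧ g 0 0 ≠ 0}]

theorem snd_ne_zero_of_fst_eq_zero (g : Matrix.SpecialLinearGroup (Fin 2) ℤ)
    (h : g 0 0 = 0) : g 1 0 ≠ 0 := by
  intro h'
  have hdet := g.det_coe
  rw [Matrix.det_fin_two, h, h'] at hdet
  simp at hdet

theorem disjoint_posSet_zero_one : Disjoint (posSet 0) (posSet 1) := by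
  refine Set.disjoint_left.mpr fun g h h' => ?_
  simp only [posSet, Matrix.cons_val_zero, Matrix.cons_val_one, Set.mem_ofPred_eq] at h h'
  rcases h' with h' | h'
  · nlinarith [sq_nonneg (g 0 0 - g 1 0)]
  · have := sq_pos_of_ne_zero (snd_ne_zero_of_fst_eq_zero g h')
    rw [h'] at h
    nlinarith

theorem disjoint_negSet_zero_one : Disjoint (negSet 0) (negSet 1) := by
  refine Set.disjoint_left.mpr fun g h h' => ?_
  simp only [negSet, Matrix.cons_val_zero, Matrix.cons_val_one, Set.mem_ofPred_eq] at h h'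
  nlinarith [sq_nonneg (g 0 0 + g 1 0)]

theorem disjoint_posSet_negSet (i j : Fin 2) : Disjoint (posSet i) (negSet j) := by
  refine Set.disjoint_left.mpr fun g h h' => ?_
  fin_cases i <;> fin_cases j <;>
    simp only [posSet, negSet, Fin.zero_eta, Fin.mk_one, Matrix.cons_val_zero,
      Matrix.cons_val_one, Set.mem_ofPred_eq] at h h'
  · nlinarith [sq_nonneg (g 1 0)]
  · have := sq_pos_of_ne_zero h'.2
    nlinarith [sq_nonneg (g 1 0)]
  · rcases h with h | h
    · nlinarith [sq_nonneg (g 0 0), sq_nonneg (g 1 0)]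
    · rw [h] at h'
      nlinarith [sq_nonneg (g 1 0)]
  · rcases h with h | h
    · nlinarith [sq_nonneg (g 0 0)]
    · exact h'.2 h

theorem sanovA_mul_apply_zero (g : Matrix.SpecialLinearGroup (Fin 2) ℤ) (j : Fin 2) :
    (sanovA * g) 0 j = g 0 j + 2 * g 1 j := by
  rw [Matrix.SpecialLinearGroup.coe_mul, Matrix.mul_apply, Fin.sum_univ_two]
  simp [sanovA]

theorem sanovA_mul_apply_one (g : Matrix.SpecialLinearGroup (Fin 2) ℤ) (j : Fin 2) :
    (sanovA * g) 1 j = g 1 j := by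
  rw [Matrix.SpecialLinearGroup.coe_mul, Matrix.mul_apply, Fin.sum_univ_two]
  simp [sanovA]

theorem sanovB_mul_apply_zero (g : Matrix.SpecialLinearGroup (Fin 2) ℤ) (j : Fin 2) :
    (sanovB * g) 0 j = g 0 j := by
  rw [Matrix.SpecialLinearGroup.coe_mul, Matrix.mul_apply, Fin.sum_univ_two]
  simp [sanovB]

theorem sanovB_mul_apply_one (g : Matrix.SpecialLinearGroup (Fin 2) ℤ) (j : Fin 2) :
    (sanovB * g) 1 j = 2 * g 0 j + g 1 j := by
  rw [Matrix.SpecialLinearGroup.coe_mul, Matrix.mul_apply, Fin.sum_univ_two]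
  simp [sanovB]

theorem mul_mem_posSet_iff (i : Fin 2) (g : Matrix.SpecialLinearGroup (Fin 2) ℤ) :
    ![sanovA, sanovB] i * g ∈ posSet i ↔ g ∉ negSet i := by
  fin_cases i
  · change 0 ≤ (sanovA * g) 1 0 * ((sanovA * g) 0 0 - (sanovA * g) 1 0) ↔
      ¬ g 1 0 * (g 0 0 + g 1 0) < 0
    rw [sanovA_mul_apply_zero, sanovA_mul_apply_one, not_lt]
    ring_nf
  · change 0 < (sanovB * g) 0 0 * ((sanovB * g) 1 0 - (sanovB * g) 0 0) ∨ (sanovB * g) 0 0 = 0 ↔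
      ¬ (g 0 0 * (g 0 0 + g 1 0) ≤ 0 ∧ g 0 0 ≠ 0)
    rw [sanovB_mul_apply_zero, sanovB_mul_apply_one, not_and_or, not_le, not_not]
    ring_nf

end Sanov

/-- the homomorphism `F₂ → SL(2,ℤ)` sending the two generators to
`[[1,2],[0,1]]` and `[[1,0],[2,1]]` is injective. -/
theorem sanov_free : Function.Injective (FreeGroup.lift ![sanovA, sanovB]) := by
  refine FreeGroup.injective_lift_of_ping_pong _ Sanov.posSet Sanov.negSet ?_ ?_ ?_
    Sanov.disjoint_posSet_negSet ?_ ?_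
  · intro i
    fin_cases i
    · exact ⟨1, by simp [Sanov.posSet]⟩
    · exact ⟨⟨!![0, -1; 1, 0], by simp⟩, Or.inr rfl⟩
  · intro i j hij
    fin_cases i <;> fin_cases j <;> first
      | exact absurd rfl hij
      | exact Sanov.disjoint_posSet_zero_one
      | exact Sanov.disjoint_posSet_zero_one.symm
  · intro i j hij
    fin_cases i <;> fin_cases j <;> first
      | exact absurd rfl hij
      | exact Sanov.disjoint_negSet_zero_one
      | exact Sanov.disjoint_negSet_zero_one.symm
  · rintro i _ ⟨g, hg, rfl⟩
    exact (Sanov.mul_mem_posSet_iff i g).mpr hg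
  · rintro i _ ⟨g, hg, rfl⟩
    by_contra h
    have := (Sanov.mul_mem_posSet_iff i _).mpr h
    exact hg (by simpa using this)
end

section
/- The subgroup of SL(2,ℤ) generated by the matrices [[1,2],[0,1]] and [[1,0],[2,1]] is exactly the set of matrices [[4a+1, 2b],[2c, 4d+1]] in SL(2,ℤ) with a,b,c,d ∈ ℤ; equivalently, it is the set of matrices in SL(2,ℤ) whose diagonal entries are congruent to 1 modulo 4 and whose off-diagonal entries are even. -/
theorem coe_sanovA :
    (sanovA : Matrix (Fin 2) (Fin 2) ℤ) = !![1, 2; 0, 1] := rfl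

theorem coe_sanovB :
    (sanovB : Matrix (Fin 2) (Fin 2) ℤ) = !![1, 0; 2, 1] := rfl

theorem coe_sanovA_zpow (n : ℤ) :
    ((sanovA ^ n : Matrix.SpecialLinearGroup (Fin 2) ℤ) : Matrix (Fin 2) (Fin 2) ℤ) =
      !![1, 2 * n; 0, 1] := by
  induction n with
  | zero => simp [Matrix.one_fin_two]
  | succ n ih =>
    rw [zpow_add_one, Matrix.SpecialLinearGroup.coe_mul, ih]
    simp [coe_sanovA]
    ring
  | pred n ih =>
    rw [zpow_sub_one, Matrix.SpecialLinearGroup.coe_mul, ih, Matrix.SpecialLinearGroup.coe_inv]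
    simp [coe_sanovA, Matrix.adjugate_fin_two_of]
    ring

theorem exists_coe_eq_of_mem_closure_sanov {M : Matrix.SpecialLinearGroup (Fin 2) ℤ}
    (hM : M ∈ Subgroup.closure {sanovA, sanovB}) :
    ∃ a b c d : ℤ,
      (M : Matrix (Fin 2) (Fin 2) ℤ) = !![4 * a + 1, 2 * b; 2 * c, 4 * d + 1] := by
  induction hM using Subgroup.closure_induction with
  | mem x hx =>
    rcases hx with rfl | rfl
    · exact ⟨0, 1, 0, 0, by simp [coe_sanovA]⟩
    · exact ⟨0, 0, 1, 0, by simp [coe_sanovB]⟩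
  | one => exact ⟨0, 0, 0, 0, by simp [Matrix.one_fin_two]⟩
  | mul x y _ _ hx hy =>
    obtain ⟨a, b, c, d, hx⟩ := hx
    obtain ⟨a', b', c', d', hy⟩ := hy
    refine ⟨4 * a * a' + a + a' + b * c', (4 * a + 1) * b' + b * (4 * d' + 1),
      c * (4 * a' + 1) + (4 * d + 1) * c', c * b' + 4 * d * d' + d + d', ?_⟩
    rw [Matrix.SpecialLinearGroup.coe_mul, hx, hy, Matrix.mul_fin_two]
    ext i j
    fin_cases i <;> fin_cases j <;> simp <;> ring
  | inv x _ hx =>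
    obtain ⟨a, b, c, d, hx⟩ := hx
    refine ⟨d, -b, -c, a, ?_⟩
    rw [Matrix.SpecialLinearGroup.coe_inv, hx, Matrix.adjugate_fin_two_of]
    simp

/-- The Euclidean algorithm on the first column, using row operations with even multipliers. -/
theorem mem_closure_sanov_of_coe_eq (M : Matrix.SpecialLinearGroup (Fin 2) ℤ) (a b c d : ℤ)
    (hM : (M : Matrix (Fin 2) (Fin 2) ℤ) = !![4 * a + 1, 2 * b; 2 * c, 4 * d + 1]) :
    M ∈ Subgroup.closure {sanovA, sanovB} := by
  have hA : sanovA ∈ Subgroup.closure {sanovA, sanovB} := Subgroup.subset_closure (by simp)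
  have hB : sanovB ∈ Subgroup.closure {sanovA, sanovB} := Subgroup.subset_closure (by simp)
  induction hn : (4 * a + 1).natAbs + (2 * c).natAbs using Nat.strong_induction_on
    generalizing M a b c d with
  | _ n ih =>
    subst hn
    by_cases hc : c = 0
    · subst hc
      have hdet : (4 * a + 1) * (4 * d + 1) = 1 := by
        have h := M.det_coe
        rw [hM, Matrix.det_fin_two_of] at h
        linarith
      have ha : a = 0 := by
        rcases Int.eq_one_or_neg_one_of_mul_eq_one hdet with h | h <;> omega
      subst ha
      have hd : d = 0 := by linarith
      subst hd
      have : M = sanovA ^ b := by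
        apply Subtype.ext
        rw [hM, coe_sanovA_zpow]
        simp
      exact this ▸ zpow_mem hA b
    by_cases hlt : (4 * a + 1).natAbs < (2 * c).natAbs
    · by_cases hs : 0 ≤ (4 * a + 1) ↔ 0 ≤ c
      · rw [← Subgroup.mul_mem_cancel_left _ (inv_mem hB)]
        refine ih _ ?_ _ a b (c - (4 * a + 1)) (d - b) ?_ rfl
        · omega
        · rw [Matrix.SpecialLinearGroup.coe_mul, Matrix.SpecialLinearGroup.coe_inv, hM, coe_sanovB,
            Matrix.adjugate_fin_two_of, Matrix.mul_fin_two]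
          ext i j
          fin_cases i <;> fin_cases j <;> simp <;> ring
      · rw [← Subgroup.mul_mem_cancel_left _ hB]
        refine ih _ ?_ _ a b (c + (4 * a + 1)) (d + b) ?_ rfl
        · omega
        · rw [Matrix.SpecialLinearGroup.coe_mul, hM, coe_sanovB, Matrix.mul_fin_two]
          ext i j
          fin_cases i <;> fin_cases j <;> simp <;> ring
    · by_cases hs : 0 ≤ (4 * a + 1) ↔ 0 ≤ c
      · rw [← Subgroup.mul_mem_cancel_left _ (inv_mem hA)]
        refine ih _ ?_ _ (a - c) (b - (4 * d + 1)) c d ?_ rfl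
        · omega
        · rw [Matrix.SpecialLinearGroup.coe_mul, Matrix.SpecialLinearGroup.coe_inv, hM, coe_sanovA,
            Matrix.adjugate_fin_two_of, Matrix.mul_fin_two]
          ext i j
          fin_cases i <;> fin_cases j <;> simp <;> ring
      · rw [← Subgroup.mul_mem_cancel_left _ hA]
        refine ih _ ?_ _ (a + c) (b + (4 * d + 1)) c d ?_ rfl
        · omega
        · rw [Matrix.SpecialLinearGroup.coe_mul, hM, coe_sanovA, Matrix.mul_fin_two]
          ext i j
          fin_cases i <;> fin_cases j <;> simp <;> ring

/-- the subgroup of `SL(2,ℤ)` generated by `[[1,2],[0,1]]` and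
`[[1,0],[2,1]]` is exactly the set of matrices of the form
`[[4a+1, 2b],[2c, 4d+1]]` with `a,b,c,d ∈ ℤ`. -/
theorem sanov_group_eq :
    ∀ M : Matrix.SpecialLinearGroup (Fin 2) ℤ,
      M ∈ Subgroup.closure {sanovA, sanovB} ↔
        ∃ a b c d : ℤ,
          (M : Matrix (Fin 2) (Fin 2) ℤ) = !![4 * a + 1, 2 * b; 2 * c, 4 * d + 1] := by
  exact fun M ↦ ⟨exists_coe_eq_of_mem_closure_sanov,
    fun ⟨a, b, c, d, hM⟩ ↦ mem_closure_sanov_of_coe_eq M a b c d hM⟩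
end

section
/- Let ℓ ≥ 1 and m ≥ 1, let G be a simple graph in which every vertex has degree exactly 2ℓ, and let α be a vertex of G. Suppose G has no cycle of length at most 2m all of whose vertices lie at graph distance at most m from α. Then for every k with 1 ≤ k ≤ m, the number of vertices v reachable from α with graph distance from α equal to k is exactly 2ℓ·(2ℓ−1)^{k−1}; that is, the ball of radius m about α is a truncated 2ℓ-regular tree. -/
namespace SimpleGraph

variable {V : Type*} {G : SimpleGraph V} {α : V} {m : ℕ}

theorem Walk.reachable_and_dist_le_of_mem_support {u v : V} (p : G.Walk u v) {w : V}
    (hw : w ∈ p.support) : G.Reachable u w ∧ G.dist u w ≤ p.length := by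
  classical
  exact ⟨⟨p.takeUntil w hw⟩, (dist_le _).trans (p.length_takeUntil_le_length hw)⟩

/-- Without short cycles in the ball of radius `m` about `α`, paths of length at most `m`
starting at `α` are determined by their endpoint. -/
theorem path_unique_of_no_short_cycles
    (hnocycle : ∀ (v : V) (w : G.Walk v v), w.IsCycle → w.length ≤ 2 * m →
      ¬ (∀ u ∈ w.support, G.Reachable α u ∧ G.dist α u ≤ m))
    {v : V} {p q : G.Walk α v} (hp : p.IsPath) (hq : q.IsPath)
    (hpm : p.length ≤ m) (hqm : q.length ≤ m) : p = q := by
  by_contra hne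
  obtain ⟨w, -, -, c, hc, hsub⟩ := hp.exists_isCycle_sublist_of_ne hq hne
  have hlen := hsub.length_le
  simp only [List.length_append, List.length_tail, List.length_reverse,
    Walk.length_support] at hlen
  refine hnocycle w c hc (by omega) fun u hu ↦ ?_
  rcases List.mem_append.1 (hsub.subset hu) with h | h
  · have := p.reachable_and_dist_le_of_mem_support h
    exact ⟨this.1, this.2.trans hpm⟩
  · have := q.reachable_and_dist_le_of_mem_support (List.mem_reverse.1 (List.mem_of_mem_tail h))
    exact ⟨this.1, this.2.trans hqm⟩

/-- If short paths from `α` are unique, then a vertex of the ball has at most one neighbor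
closer to `α`. -/
theorem eq_of_adj_of_dist_add_one
    (huniq : ∀ (v : V) (p q : G.Walk α v), p.IsPath → q.IsPath → p.length ≤ m → q.length ≤ m →
      p = q)
    {x y v : V} (hv : G.dist α v ≤ m) (hx : G.Reachable α x) (hy : G.Reachable α y)
    (hxv : G.Adj x v) (hyv : G.Adj y v) (hdx : G.dist α v = G.dist α x + 1)
    (hdy : G.dist α v = G.dist α y + 1) : x = y := by
  obtain ⟨p, hp⟩ := hx.exists_walk_length_eq_dist
  obtain ⟨q, hq⟩ := hy.exists_walk_length_eq_dist
  have hp' : (p.concat hxv).length = G.dist α v := by rw [Walk.length_concat]; omega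
  have hq' : (q.concat hyv).length = G.dist α v := by rw [Walk.length_concat]; omega
  exact (Walk.concat_inj (huniq v _ _ (Walk.isPath_of_length_eq_dist _ hp')
    (Walk.isPath_of_length_eq_dist _ hq') (by omega) (by omega))).1

/-- If short paths from `α` are unique, then there is no edge inside a sphere of radius less
than `m`. -/
theorem dist_ne_of_adj_of_path_unique
    (huniq : ∀ (v : V) (p q : G.Walk α v), p.IsPath → q.IsPath → p.length ≤ m → q.length ≤ m →
      p = q)
    {x v : V} (hx : G.Reachable α x) (hxv : G.Adj x v) (hm : G.dist α x < m) :
    G.dist α v ≠ G.dist α x := by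
  classical
  intro hd
  obtain ⟨p, hp, hpl⟩ := hx.exists_path_of_dist
  obtain ⟨q, hq, hql⟩ := (hx.trans hxv.reachable).exists_path_of_dist
  have hvp : v ∉ p.support := fun h ↦ by
    have h₁ := Walk.length_takeUntil_lt_length h hxv.ne'
    have h₂ := dist_le (p.takeUntil v h)
    omega
  have heq := huniq v (p.concat hxv) q (hp.concat hvp hxv)
    hq (by rw [Walk.length_concat]; omega) (by omega)
  have := congrArg Walk.length heq
  rw [Walk.length_concat] at this
  omega

/-- A vertex at positive distance from `α` has a neighbor one step closer to `α`. -/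
theorem exists_adj_of_dist_eq_add_one {v : V} {k : ℕ} (h : G.dist α v = k + 1) :
    ∃ x, G.Adj x v ∧ G.Reachable α x ∧ G.dist α x = k := by
  obtain ⟨p, hp⟩ := exists_walk_of_dist_ne_zero (G := G) (u := α) (v := v) (by omega)
  have hnil : ¬ p.Nil := fun hn ↦ by
    have := Walk.length_eq_zero_iff.2 hn
    omega
  have hadj := p.adj_penultimate hnil
  have hle := dist_le p.dropLast
  have hlen : p.dropLast.length = k := by simp [Walk.length_dropLast]; omega
  have htri := hadj.reachable.dist_triangle_right α
  rw [dist_eq_one_iff_adj.2 hadj] at htri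
  exact ⟨p.penultimate, hadj, ⟨p.dropLast⟩, by omega⟩

/-- In a regular graph in which short paths from `α` are unique, every vertex of the sphere of
radius `k + 1 < m` has all but one of its neighbors in the next sphere. -/
theorem card_neighborFinset_filter_dist [G.LocallyFinite] {d k : ℕ}
    (hreg : ∀ v : V, G.degree v = d)
    (huniq : ∀ (v : V) (p q : G.Walk α v), p.IsPath → q.IsPath → p.length ≤ m → q.length ≤ m →
      p = q)
    {v : V} (hv : G.dist α v = k + 1) (hk : k + 1 < m) :
    ((G.neighborFinset v).filter fun u ↦ G.dist α u = k + 2).card = d - 1 := by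
  classical
  obtain ⟨x, hxv, hx, hdx⟩ := exists_adj_of_dist_eq_add_one hv
  have hreach : G.Reachable α v := hx.trans hxv.reachable
  have : (G.neighborFinset v).filter (fun u ↦ G.dist α u = k + 2) =
      (G.neighborFinset v).erase x := by
    ext u
    simp only [Finset.mem_filter, Finset.mem_erase, mem_neighborFinset]
    refine ⟨fun ⟨h, hd⟩ ↦ ⟨by rintro rfl; omega, h⟩, fun ⟨hne, h⟩ ↦ ⟨h, ?_⟩⟩
    have hsame := dist_ne_of_adj_of_path_unique huniq hreach h (by omega)
    rcases h.diff_dist_adj (u := α) with hd | hd | hd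
    · exact absurd hd hsame
    · omega
    · exact absurd (eq_of_adj_of_dist_add_one huniq (by omega) (hreach.trans h.reachable) hx
        h.symm hxv (by omega) (by omega)) hne
  rw [this, Finset.card_erase_of_mem (by simpa using hxv.symm), card_neighborFinset_eq_degree, hreg]

/-- In a `d`-regular graph in which short paths from `α` are unique, the spheres about `α` have
the cardinality of the spheres in the `d`-regular tree. -/
theorem exists_finset_sphere [G.LocallyFinite] {d : ℕ} (hreg : ∀ v : V, G.degree v = d)
    (huniq : ∀ (v : V) (p q : G.Walk α v), p.IsPath → q.IsPath → p.length ≤ m → q.length ≤ m →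
      p = q) (k : ℕ) (hk : k + 1 ≤ m) :
    ∃ T : Finset V, (∀ v, v ∈ T ↔ G.Reachable α v ∧ G.dist α v = k + 1) ∧
      T.card = d * (d - 1) ^ k := by
  classical
  induction k with
  | zero =>
    refine ⟨G.neighborFinset α, fun v ↦ ?_, by simp [hreg]⟩
    simpa using fun h : G.Adj α v ↦ h.reachable
  | succ k ih =>
    obtain ⟨T, hT, hcard⟩ := ih (by omega)
    refine ⟨T.biUnion fun x ↦ (G.neighborFinset x).filter fun u ↦ G.dist α u = k + 2,
      fun v ↦ ?_, ?_⟩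
    · simp only [Finset.mem_biUnion, Finset.mem_filter, mem_neighborFinset]
      constructor
      · rintro ⟨x, hx, hxv, hd⟩
        exact ⟨((hT x).1 hx).1.trans hxv.reachable, hd⟩
      · rintro ⟨-, hd⟩
        obtain ⟨x, hxv, hx, hdx⟩ := exists_adj_of_dist_eq_add_one hd
        exact ⟨x, (hT x).2 ⟨hx, hdx⟩, hxv, hd⟩
    · rw [Finset.card_biUnion, Finset.sum_congr rfl fun x hx ↦
        card_neighborFinset_filter_dist hreg huniq ((hT x).1 hx).2 (by omega)]
      · rw [Finset.sum_const, hcard, smul_eq_mul, pow_succ, mul_assoc]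
      · intro x hx y hy hxy
        rw [Function.onFun, Finset.disjoint_left]
        intro v hv hv'
        simp only [Finset.mem_filter, mem_neighborFinset] at hv hv'
        obtain ⟨hrx, hdx⟩ := (hT x).1 hx
        obtain ⟨hry, hdy⟩ := (hT y).1 hy
        exact hxy (eq_of_adj_of_dist_add_one huniq (by omega) hrx hry hv.1 hv'.1
          (by omega) (by omega))

end SimpleGraph


/-- in a `2ℓ`-regular graph with no cycle of length at most `2m` lying
entirely within distance `m` of `α`, the sphere of radius `k` about `α` has exactly
`2ℓ(2ℓ-1)^(k-1)` vertices for `1 ≤ k ≤ m`; i.e. the ball of radius `m` is a truncated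
`2ℓ`-regular tree. -/
theorem sphere_card_of_no_short_cycles {V : Type*} (G : SimpleGraph V) [G.LocallyFinite]
    (ℓ m : ℕ) (hℓ : 1 ≤ ℓ) (hm : 1 ≤ m)
    (hreg : ∀ v : V, G.degree v = 2 * ℓ) (α : V)
    (hnocycle : ∀ (v : V) (w : G.Walk v v), w.IsCycle → w.length ≤ 2 * m →
      ¬ (∀ u ∈ w.support, G.Reachable α u ∧ G.dist α u ≤ m)) :
    ∀ k : ℕ, 1 ≤ k → k ≤ m →
      Nat.card {v : V | G.Reachable α v ∧ G.dist α v = k} =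
        2 * ℓ * (2 * ℓ - 1) ^ (k - 1) := by
  intro k hk hkm
  obtain ⟨T, hT, hcard⟩ := SimpleGraph.exists_finset_sphere hreg
    (fun _ _ _ ↦ SimpleGraph.path_unique_of_no_short_cycles hnocycle) (k - 1) (by omega)
  rw [← hcard]
  refine Nat.subtype_card T fun v ↦ ?_
  rw [hT, Nat.sub_add_cancel hk, Set.mem_ofPred_eq]
end

section
/- Let G and G' be locally finite simple graphs with vertices α in G and β in G', and let m ≥ 0. Let B be the set of vertices of G at graph distance at most m from α and B' the set of vertices of G' at graph distance at most m from β. If there is a graph isomorphism between the subgraphs induced on B and on B' carrying α to β, then the number of closed walks of length m in G based at α equals the number of closed walks of length m in G' based at β. -/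
namespace SimpleGraph

/-- A walk whose vertices all lie in the range of a graph embedding lifts along it. -/
theorem Walk.exists_map_copy_eq {V W : Type*} {G : SimpleGraph V} {H : SimpleGraph W}
    (f : G ↪g H) {x y : W} (w : H.Walk x y) (hw : ∀ z ∈ w.support, z ∈ Set.range f)
    {u v : V} (hu : f u = x) (hv : f v = y) :
    ∃ p : G.Walk u v, (p.map f.toHom).copy hu hv = w := by
  induction w generalizing u with
  | nil =>
    obtain rfl : u = v := f.injective (hu.trans hv.symm)
    subst hu
    exact ⟨.nil, rfl⟩
  | @cons x z y h q ih =>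
    obtain ⟨t, rfl⟩ := hw z (by simp)
    obtain ⟨p, hp⟩ := ih (fun a ha => hw a (by simp [ha])) rfl hv
    subst hu hv
    refine ⟨.cons (f.map_adj_iff.1 h) p, ?_⟩
    rw [← hp]
    rfl

/-- A graph embedding whose range contains every walk of length `n` between the images of `u`
and `v` preserves the number of such walks. -/
theorem card_walks_eq_of_embedding {V W : Type*} {G : SimpleGraph V} {H : SimpleGraph W}
    (f : G ↪g H) (u v : V) (n : ℕ)
    (hf : ∀ w : H.Walk (f u) (f v), w.length = n → ∀ z ∈ w.support, z ∈ Set.range f) :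
    Nat.card {w : G.Walk u v // w.length = n} =
      Nat.card {w : H.Walk (f u) (f v) // w.length = n} := by
  refine Nat.card_eq_of_bijective
    (fun p => ⟨p.1.map f.toHom, (p.1.length_map f.toHom).trans p.2⟩) ⟨fun p q h => ?_, ?_⟩
  · exact Subtype.ext (Walk.map_injective_of_injective (f := f.toHom) f.injective u v
      (congrArg Subtype.val h))
  · rintro ⟨w, hw⟩
    obtain ⟨p, rfl⟩ := w.exists_map_copy_eq f (hf w hw) rfl rfl
    exact ⟨⟨p, (p.length_map f.toHom).symm.trans hw⟩, rfl⟩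

/-- Closed walks of length `n` at `a` can be counted inside any induced subgraph containing the
ball of radius `n` about `a`. -/
theorem card_closed_walks_induce_eq {V : Type*} (G : SimpleGraph V) (s : Set V) (n : ℕ) (a : s)
    (hs : ∀ v, G.Reachable a v → G.dist a v ≤ n → v ∈ s) :
    Nat.card {w : (G.induce s).Walk a a // w.length = n} =
      Nat.card {w : G.Walk (a : V) a // w.length = n} := by
  classical
  refine card_walks_eq_of_embedding (Embedding.induce s) a a n fun w hw z hz => ?_
  have hdist : G.dist (a : V) z ≤ n :=
    (dist_le (w.takeUntil z hz)).trans ((w.length_takeUntil_le_length hz).trans hw.le)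
  exact ⟨⟨z, hs z ⟨w.takeUntil z hz⟩ hdist⟩, rfl⟩

end SimpleGraph


/-- if the balls of radius `m` about `α` in `G` and about `β` in `G'`
are isomorphic as induced subgraphs via an isomorphism sending `α` to `β`, then `G` and
`G'` have the same number of closed walks of length `m` based at `α` and `β`
respectively. -/
theorem card_closed_walks_eq_of_ball_iso {V V' : Type*}
    (G : SimpleGraph V) (G' : SimpleGraph V')
    [G.LocallyFinite] [G'.LocallyFinite]
    (α : V) (β : V') (m : ℕ)
    (B : Set V) (hB : B = {v : V | G.Reachable α v ∧ G.dist α v ≤ m})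
    (B' : Set V') (hB' : B' = {v : V' | G'.Reachable β v ∧ G'.dist β v ≤ m})
    (hα : α ∈ B) (hβ : β ∈ B')
    (φ : G.induce B ≃g G'.induce B') (hφ : φ ⟨α, hα⟩ = ⟨β, hβ⟩) :
    Nat.card {w : G.Walk α α // w.length = m} =
      Nat.card {w : G'.Walk β β // w.length = m} := by
  subst hB hB'
  rw [← G.card_closed_walks_induce_eq _ m ⟨α, hα⟩ fun v hr hd => ⟨hr, hd⟩,
    ← G'.card_closed_walks_induce_eq _ m ⟨β, hβ⟩ fun v hr hd => ⟨hr, hd⟩, ← hφ]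
  exact SimpleGraph.card_walks_eq_of_embedding φ.toEmbedding _ _ m
    fun w _ z _ => φ.surjective z
end

section
/- Let R > 0, let μ and μ_n (n ∈ ℕ) be Borel probability measures on ℝ all supported in the compact interval [−R, R], and suppose that for every natural number k the k-th moments converge: ∫ x^k dμ_n(x) → ∫ x^k dμ(x) as n → ∞. Then μ_n converges weakly to μ; that is, for every bounded continuous function f : ℝ → ℝ, ∫ f dμ_n → ∫ f dμ. -/
open MeasureTheory Filter

/-- A continuous function is integrable for a finite measure carried by a compact interval. -/
theorem integrable_of_continuous_of_ae_mem_Icc {ν : Measure ℝ} [IsFiniteMeasure ν] {a b : ℝ}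
    (hν : ∀ᵐ x ∂ν, x ∈ Set.Icc a b) {f : ℝ → ℝ} (hf : Continuous f) : Integrable f ν := by
  obtain ⟨C, hC⟩ := isCompact_Icc.exists_bound_of_continuousOn (hf.continuousOn (s := Set.Icc a b))
  exact Integrable.of_bound hf.aestronglyMeasurable C (hν.mono hC)

/-- The integral of a polynomial is the corresponding linear combination of moments. -/
theorem integral_polynomial_eval_eq_sum {ν : Measure ℝ}
    (hν : ∀ k : ℕ, Integrable (fun x => x ^ k) ν) (p : Polynomial ℝ) :
    ∫ x, p.eval x ∂ν = p.sum fun k c => c * ∫ x, x ^ k ∂ν := by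
  simp only [Polynomial.eval_eq_sum, Polynomial.sum_def]
  rw [integral_finsetSum _ fun k _ => (hν k).const_mul _]
  simp only [integral_const_mul]

/-- If two functions are uniformly `ε`-close almost everywhere for a probability measure, then so
are their integrals. -/
theorem abs_integral_sub_integral_le {ν : Measure ℝ} [IsProbabilityMeasure ν] {f g : ℝ → ℝ}
    (hf : Integrable f ν) (hg : Integrable g ν) {ε : ℝ} (h : ∀ᵐ x ∂ν, ‖f x - g x‖ ≤ ε) :
    |∫ x, f x ∂ν - ∫ x, g x ∂ν| ≤ ε := by
  rw [← integral_sub hf hg]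
  simpa using norm_integral_le_of_norm_le_const h

/-- for probability measures on `ℝ` all supported in `[-R, R]`,
convergence of all moments implies weak convergence. -/
theorem tendsto_integral_of_tendsto_moments
    (R : ℝ) (hR : 0 < R)
    (μ : Measure ℝ) (μs : ℕ → Measure ℝ)
    [IsProbabilityMeasure μ] [∀ n, IsProbabilityMeasure (μs n)]
    (hμ : μ (Set.Icc (-R) R) = 1) (hμs : ∀ n, μs n (Set.Icc (-R) R) = 1)
    (hmom : ∀ k : ℕ,
      Tendsto (fun n => ∫ x, x ^ k ∂(μs n)) atTop (nhds (∫ x, x ^ k ∂μ))) :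
    ∀ f : ℝ → ℝ, Continuous f → (∃ C : ℝ, ∀ x, |f x| ≤ C) →
      Tendsto (fun n => ∫ x, f x ∂(μs n)) atTop (nhds (∫ x, f x ∂μ)) := by
  intro f hf _
  have hμ' : ∀ᵐ x ∂μ, x ∈ Set.Icc (-R) R := mem_ae_iff_prob_eq_one measurableSet_Icc |>.2 hμ
  have hμs' n : ∀ᵐ x ∂(μs n), x ∈ Set.Icc (-R) R :=
    mem_ae_iff_prob_eq_one measurableSet_Icc |>.2 (hμs n)
  rw [Metric.tendsto_atTop]
  intro ε hε
  obtain ⟨p, hp⟩ := exists_polynomial_near_of_continuousOn (-R) R f hf.continuousOn (ε / 3)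
    (by positivity)
  have hpoly : Tendsto (fun n => ∫ x, p.eval x ∂(μs n)) atTop (nhds (∫ x, p.eval x ∂μ)) := by
    simp only [integral_polynomial_eval_eq_sum fun k =>
        integrable_of_continuous_of_ae_mem_Icc hμ' (continuous_pow k),
      fun n => integral_polynomial_eval_eq_sum (fun k =>
        integrable_of_continuous_of_ae_mem_Icc (hμs' n) (continuous_pow k)), Polynomial.sum_def]
    exact tendsto_finsetSum _ fun k _ => (hmom k).const_mul _
  have hclose {ν : Measure ℝ} [IsProbabilityMeasure ν] (hν : ∀ᵐ x ∂ν, x ∈ Set.Icc (-R) R) :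
      |∫ x, p.eval x ∂ν - ∫ x, f x ∂ν| ≤ ε / 3 :=
    abs_integral_sub_integral_le (integrable_of_continuous_of_ae_mem_Icc hν p.continuous)
      (integrable_of_continuous_of_ae_mem_Icc hν hf) (hν.mono fun x hx => (hp x hx).le)
  obtain ⟨N, hN⟩ := Metric.tendsto_atTop.1 hpoly (ε / 3) (by positivity)
  refine ⟨N, fun n hn => ?_⟩
  have h₁ := abs_le.1 (hclose (hμs' n))
  have h₂ := abs_le.1 (hclose hμ')
  have h₃ := abs_lt.1 (Real.dist_eq _ _ ▸ hN n hn)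
  rw [Real.dist_eq, abs_lt]
  constructor <;> linarith
end

section
/- For every ℓ ≥ 1, the free group on ℓ generators F_ℓ is residually finite: for every g ∈ F_ℓ with g ≠ 1 there exists a normal subgroup N of F_ℓ of finite index such that g ∉ N. -/
/-- Left multiplication by `a` restricted to a finite set `S` of a group extends to a permutation
of `S`. -/
theorem exists_perm_extending_mul_left {G : Type*} [Group G] (S : Set G) [Finite S] (a : G) :
    ∃ σ : Equiv.Perm S, ∀ (x : G) (hx : x ∈ S) (hax : a * x ∈ S), σ ⟨x, hx⟩ = ⟨a * x, hax⟩ := by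
  obtain ⟨σ, hσ⟩ := Equiv.Perm.exists_extending_pair
    (fun x : {x : S // a * (x : G) ∈ S} ↦ x.1)
    (fun x : {x : S // a * (x : G) ∈ S} ↦ (⟨a * (x.1 : G), x.2⟩ : S))
    Subtype.val_injective
    (fun x y h ↦ Subtype.ext (Subtype.ext (mul_left_cancel (congrArg Subtype.val h))))
  exact ⟨σ, fun x hx hax ↦ hσ ⟨⟨x, hx⟩, hax⟩⟩

/-- If each generator acts on `S` by a permutation extending left multiplication, then a word all
of whose suffixes represent elements of `S` sends `1` to the element it represents. -/
theorem FreeGroup.lift_mk_apply_one {α : Type*} (S : Set (FreeGroup α)) (h1 : 1 ∈ S)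
    (σ : α → Equiv.Perm S)
    (hσ : ∀ a x (hx : x ∈ S) (hax : FreeGroup.of a * x ∈ S),
      σ a ⟨x, hx⟩ = ⟨FreeGroup.of a * x, hax⟩)
    (L : List (α × Bool)) (hL : ∀ T, T <:+ L → FreeGroup.mk T ∈ S) :
    FreeGroup.lift σ (FreeGroup.mk L) ⟨1, h1⟩ = ⟨FreeGroup.mk L, hL L List.suffix_rfl⟩ := by
  induction L with
  | nil => rfl
  | cons p L ih =>
    have hL' : ∀ T, T <:+ L → FreeGroup.mk T ∈ S :=
      fun T hT ↦ hL T (hT.trans (List.suffix_cons p L))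
    have hmem := hL (p :: L) List.suffix_rfl
    obtain ⟨a, b⟩ := p
    cases b with
    | true =>
      have hmk : FreeGroup.mk ((a, true) :: L) = FreeGroup.of a * FreeGroup.mk L := rfl
      simp only [hmk] at hmem ⊢
      rw [_root_.map_mul, Equiv.Perm.mul_apply, ih hL', FreeGroup.lift_apply_of]
      exact hσ a _ _ hmem
    | false =>
      have hmk : FreeGroup.mk ((a, false) :: L) = (FreeGroup.of a)⁻¹ * FreeGroup.mk L := rfl
      simp only [hmk] at hmem ⊢
      rw [_root_.map_mul, Equiv.Perm.mul_apply, ih hL', _root_.map_inv, FreeGroup.lift_apply_of,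
        Equiv.Perm.inv_eq_iff_eq,
        hσ a _ hmem (by rw [mul_inv_cancel_left]; exact hL' L List.suffix_rfl)]
      simp only [mul_inv_cancel_left]

/-- for every `ℓ ≥ 1`, the free group on `ℓ` generators is residually
finite: every nonidentity element avoids some finite-index normal subgroup. -/
theorem freeGroup_residually_finite (ℓ : ℕ) (hℓ : 1 ≤ ℓ) :
    ∀ g : FreeGroup (Fin ℓ), g ≠ 1 →
      ∃ N : Subgroup (FreeGroup (Fin ℓ)), N.Normal ∧ N.FiniteIndex ∧ g ∉ N := by
  intro g hg
  set L := g.toWord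
  let S : Set (FreeGroup (Fin ℓ)) := FreeGroup.mk '' {T | T <:+ L}
  have hfin : Finite S := by
    refine (Set.Finite.image _ ((List.finite_toSet L.tails).subset fun T hT ↦ ?_)).to_subtype
    exact (List.mem_tails _ _).2 hT
  have hS : ∀ T, T <:+ L → FreeGroup.mk T ∈ S := fun T hT ↦ ⟨T, hT, rfl⟩
  have h1 : 1 ∈ S := hS [] List.nil_suffix
  choose σ hσ using fun a : Fin ℓ ↦ exists_perm_extending_mul_left S (FreeGroup.of a)
  refine ⟨(FreeGroup.lift σ).ker, inferInstance, inferInstance, fun hker ↦ hg ?_⟩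
  have h := FreeGroup.lift_mk_apply_one S h1 σ hσ L hS
  simp only [L, FreeGroup.mk_toWord, MonoidHom.mem_ker.1 hker, Equiv.Perm.one_apply] at h
  exact (congrArg Subtype.val h).symm
end
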